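/- arXiv:1811.00584 — 2 statements merged into one kernel-verified Lean document; each statement's English description precedes it below -/
import Mathlib

section
/- Let n and k be positive natural numbers with gcd(k, n) = 1, and let ω ∈ ℂ be a primitive n-th root of unity. Let f : ℂ × ℂ → ℂ be differentiable at (0,0) with nonzero derivative, i.e. fderiv ℂ f (0,0) ≠ 0, and suppose that f(ω·x, ω^k·y) = f(x, y) for all (x, y) in some neighborhood of (0,0). Then n = 1. -/
/-- If `ω` is a primitive `n`-th root of unity with `gcd(k, n) = 1`, and `f : ℂ × ℂ → ℂ` is
differentiable at `(0,0)` with nonzero derivative there, and `f (ω·x, ω^k·y) = f (x, y)` on a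
neighborhood of `(0,0)`, then `n = 1`. -/
theorem stmt0 (n k : ℕ) (hn : 0 < n) (hk : 0 < k) (hgcd : Nat.gcd k n = 1)
    (ω : ℂ) (hω1 : ω ^ n = 1) (hωprim : ∀ m : ℕ, 0 < m → m < n → ω ^ m ≠ 1)
    (f : ℂ × ℂ → ℂ) (hdiff : DifferentiableAt ℂ f (0, 0))
    (hderiv : fderiv ℂ f (0, 0) ≠ 0)
    (hinv : ∃ U ∈ nhds ((0 : ℂ), (0 : ℂ)), ∀ p ∈ U, f (ω * p.1, ω ^ k * p.2) = f p) :
    n = 1 := by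
  by_contra hne
  have hω : ω ≠ 1 := by
    have := hωprim 1 one_pos (by omega)
    simpa using this
  have hωk : ω ^ k ≠ 1 := by
    intro h
    have h1 : ω ^ (Nat.gcd k n) = 1 := pow_gcd_eq_one.2 ⟨h, hω1⟩
    rw [hgcd, pow_one] at h1
    exact hω h1
  obtain ⟨U, hU, hf⟩ := hinv
  let L : ℂ × ℂ →L[ℂ] ℂ × ℂ :=
    (ω • ContinuousLinearMap.fst ℂ ℂ ℂ).prod (ω ^ k • ContinuousLinearMap.snd ℂ ℂ ℂ)
  have hL0 : L (0, 0) = (0, 0) := by simp [L]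
  have hD : HasFDerivAt f (fderiv ℂ f (0, 0)) (L (0, 0)) := by
    rw [hL0]; exact hdiff.hasFDerivAt
  have h1 := hD.comp (0, 0) L.hasFDerivAt
  have heq : (f ∘ L) =ᶠ[nhds ((0 : ℂ), (0 : ℂ))] f := by
    filter_upwards [hU] with p hp
    simpa [L] using hf p hp
  have h2 := (hdiff.hasFDerivAt.congr_of_eventuallyEq heq)
  have h3 := h1.unique h2
  generalize fderiv ℂ f (0, 0) = D at *
  have ha : D (1, 0) = 0 := by
    have h := DFunLike.congr_fun h3 ((1 : ℂ), (0 : ℂ))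
    have e : L (1, 0) = ω • ((1 : ℂ), (0 : ℂ)) := by simp [L]
    rw [ContinuousLinearMap.comp_apply, e, map_smul, smul_eq_mul] at h
    by_contra h0
    exact hω (mul_right_cancel₀ h0 (by rw [h, one_mul]))
  have hb : D (0, 1) = 0 := by
    have h := DFunLike.congr_fun h3 ((0 : ℂ), (1 : ℂ))
    have e : L (0, 1) = ω ^ k • ((0 : ℂ), (1 : ℂ)) := by simp [L]
    rw [ContinuousLinearMap.comp_apply, e, map_smul, smul_eq_mul] at h
    by_contra h0
    exact hωk (mul_right_cancel₀ h0 (by rw [h, one_mul]))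
  apply hderiv
  ext
  · simpa using ha
  · simpa using hb
end

section
/- Let n be a positive natural number and let g be a 2 × 2 complex matrix satisfying g^n = 1, such that for every m with 0 < m < n and every nonzero vector v ∈ ℂ², g^m · v ≠ v (no nontrivial power of g fixes a nonzero vector). Then there exist ω ∈ ℂ a primitive n-th root of unity, a natural number k with gcd(k, n) = 1, and an invertible 2 × 2 complex matrix P such that P · g · P⁻¹ is the diagonal matrix diag(ω, ω^k). -/
theorem aux_semisimple (n : ℕ) (hn : 0 < n) (f : Module.End ℂ (Fin 2 → ℂ)) (hf : f ^ n = 1) :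
    f.IsSemisimple := by
  have hs : (Polynomial.X ^ n - 1 : Polynomial ℂ).Separable := by
    have := Polynomial.separable_X_pow_sub_C (F := ℂ) (n := n) 1 (by exact_mod_cast hn.ne') one_ne_zero
    simpa using this
  refine Module.End.isSemisimple_of_squarefree_aeval_eq_zero hs.squarefree ?_
  simp [hf]

theorem aux_basis (g : Matrix (Fin 2) (Fin 2) ℂ) (hs : Module.End.IsSemisimple (Matrix.toLin' g)) :
    ∃ (v w : Fin 2 → ℂ) (a b : ℂ), v 0 * w 1 - v 1 * w 0 ≠ 0 ∧
      g.mulVec v = a • v ∧ g.mulVec w = b • w := by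
  obtain ⟨a, ha⟩ := Module.End.exists_eigenvalue (Matrix.toLin' g)
  obtain ⟨v, hv⟩ := ha.exists_hasEigenvector
  have hv1 : g.mulVec v = a • v := by simpa using hv.apply_eq_smul
  by_contra hcon
  push Not at hcon
  let φ : (Fin 2 → ℂ) →ₗ[ℂ] ℂ := v 0 • LinearMap.proj 1 - v 1 • LinearMap.proj 0
  have hφ : ∀ w, φ w = v 0 * w 1 - v 1 * w 0 := fun w => by simp [φ]
  have htop : (⊤ : Submodule ℂ (Fin 2 → ℂ)) ≤ LinearMap.ker φ := by
    rw [← hs.iSup_eigenspace_eq_top]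
    refine iSup_le fun b w hw => ?_
    rw [LinearMap.mem_ker, hφ]
    by_contra h
    refine hcon v w a b h hv1 ?_
    simpa using Module.End.mem_eigenspace_iff.1 hw
  have h0 : φ ![0, 1] = 0 := htop (Submodule.mem_top)
  have h1 : φ ![1, 0] = 0 := htop (Submodule.mem_top)
  rw [hφ] at h0 h1
  apply hv.2
  ext i
  fin_cases i
  · simpa using h0
  · simpa using h1

theorem aux_pow (g : Matrix (Fin 2) (Fin 2) ℂ) (v : Fin 2 → ℂ) (a : ℂ)
    (h : g.mulVec v = a • v) (m : ℕ) : (g ^ m).mulVec v = a ^ m • v := by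
  induction m with
  | zero => simp
  | succ k ih => rw [pow_succ, ← Matrix.mulVec_mulVec, h, Matrix.mulVec_smul, ih, smul_smul, pow_succ, mul_comm]

/-- If `g` is a `2 × 2` complex matrix with `g ^ n = 1` such that no power `g ^ m` with
`0 < m < n` fixes a nonzero vector, then `g` is conjugate to a diagonal matrix
`diag(ω, ω^k)` where `ω` is a primitive `n`-th root of unity and `gcd(k, n) = 1`. -/
theorem stmt4 (n : ℕ) (hn : 0 < n) (g : Matrix (Fin 2) (Fin 2) ℂ)
    (hgn : g ^ n = 1)
    (hfree : ∀ m : ℕ, 0 < m → m < n → ∀ v : Fin 2 → ℂ, v ≠ 0 → (g ^ m).mulVec v ≠ v) :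
    ∃ (ω : ℂ) (k : ℕ) (P : Matrix (Fin 2) (Fin 2) ℂ),
      (ω ^ n = 1 ∧ ∀ m : ℕ, 0 < m → m < n → ω ^ m ≠ 1) ∧
      Nat.gcd k n = 1 ∧ IsUnit P ∧
      P * g * P⁻¹ = Matrix.diagonal ![ω, ω ^ k] := by
  have hs : Module.End.IsSemisimple (Matrix.toLin' g) := by
    refine aux_semisimple n hn _ ?_
    rw [← Matrix.toLin'_pow, hgn, Matrix.toLin'_one]
    rfl
  obtain ⟨v, w, a, b, hd, hv, hw⟩ := aux_basis g hs
  have key : ∀ (u : Fin 2 → ℂ) (c : ℂ), u ≠ 0 → g.mulVec u = c • u →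
      c ^ n = 1 ∧ ∀ m : ℕ, 0 < m → m < n → c ^ m ≠ 1 := by
    intro u c hu h
    refine ⟨?_, fun m h0 h1 h2 => hfree m h0 h1 u hu ?_⟩
    · have := aux_pow g u c h n
      rw [hgn, Matrix.one_mulVec] at this
      have h3 : (c ^ n - 1) • u = 0 := by rw [sub_smul, ← this]; simp
      rcases smul_eq_zero.1 h3 with h4 | h4
      · exact sub_eq_zero.1 h4
      · exact absurd h4 hu
    · rw [aux_pow g u c h m, h2, one_smul]
  have hv0 : v ≠ 0 := by rintro rfl; simp at hd
  have hw0 : w ≠ 0 := by rintro rfl; simp at hd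
  have ka := key v a hv0 hv
  have kb := key w b hw0 hw
  have pa : IsPrimitiveRoot a n := IsPrimitiveRoot.mk_of_lt a hn ka.1 ka.2
  have pb : IsPrimitiveRoot b n := IsPrimitiveRoot.mk_of_lt b hn kb.1 kb.2
  have : NeZero n := ⟨hn.ne'⟩
  obtain ⟨k, -, hk⟩ := pa.eq_pow_of_pow_eq_one kb.1
  have hQ : IsUnit (!![v 0, w 0; v 1, w 1] : Matrix (Fin 2) (Fin 2) ℂ).det := by
    rw [Matrix.det_fin_two_of, isUnit_iff_ne_zero]
    intro h
    exact hd (by linear_combination h)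
  refine ⟨a, k, (!![v 0, w 0; v 1, w 1])⁻¹, ka, ?_, ?_, ?_⟩
  · rw [← hk] at pb
    exact (pa.pow_iff_coprime hn k).1 pb
  · exact (Matrix.isUnit_nonsing_inv_iff).2 ((Matrix.isUnit_iff_isUnit_det _).2 hQ)
  · rw [Matrix.nonsing_inv_nonsing_inv _ hQ, hk, mul_assoc]
    have : g * !![v 0, w 0; v 1, w 1] = !![v 0, w 0; v 1, w 1] * Matrix.diagonal ![a, b] := by
      have v0 := congrFun hv 0
      have v1 := congrFun hv 1
      have w0 := congrFun hw 0
      have w1 := congrFun hw 1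
      simp [Matrix.mulVec, dotProduct, Fin.sum_univ_two] at v0 v1 w0 w1
      ext i j
      fin_cases i <;> fin_cases j <;>
        simp [Matrix.mul_apply, Fin.sum_univ_two, Matrix.diagonal] <;> grind
    rw [this, Matrix.nonsing_inv_mul_cancel_left _ _ hQ]
end
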